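/- arXiv:2405.18454 — 5 statements merged into one kernel-verified Lean document; each statement's English description precedes it below -/
import Mathlib

section
/- Let N be a positive integer, let Γ be a real 2N×2N diagonal matrix with nonnegative diagonal entries satisfying (JΓ)^T = −JΓ, and let M be a real 2N×2N matrix satisfying (JM)^T = JM. Let ω be a real number such that iωI + Γ − M is invertible, and set S(ω) = √(2Γ)(iωI + Γ − M)⁻¹√(2Γ) − I. Then S(ω) is conjugate-symplectic: S(ω) J S(ω)† = J, where † denotes the conjugate transpose. -/
open Matrix

/-- If `D` commutes with `J` and `D ^ 2 * J = A * J + J * B`, with `X` a left inverse of `A` and `Y`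
a right inverse of `B`, then `(D * X * D - 1) * J * (D * Y * D - 1) = J`. -/
theorem cayley_transform_mul_mul_eq {R : Type*} [Ring R] {D J A B X Y : R}
    (hDJ : Commute D J) (hXA : X * A = 1) (hBY : B * Y = 1)
    (h : D * D * J = A * J + J * B) :
    (D * X * D - 1) * J * (D * Y * D - 1) = J := by
  have hmid : X * (D * D * J) * Y = J * Y + X * J := by
    rw [h, mul_add, add_mul, ← mul_assoc X A, hXA, one_mul, mul_assoc X, mul_assoc J, hBY, mul_one]
  have hprod : D * X * D * J * (D * Y * D) = J * (D * Y * D) + D * X * D * J :=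
    calc D * X * D * J * (D * Y * D) = D * X * D * (J * D) * Y * D := by noncomm_ring
      _ = D * (X * (D * D * J) * Y) * D := by rw [← hDJ.eq]; noncomm_ring
      _ = (D * J) * Y * D + D * X * (J * D) := by rw [hmid]; noncomm_ring
      _ = J * D * Y * D + D * X * (D * J) := by rw [hDJ.eq]
      _ = J * (D * Y * D) + D * X * D * J := by noncomm_ring
  calc (D * X * D - 1) * J * (D * Y * D - 1)
      = D * X * D * J * (D * Y * D) - J * (D * Y * D) - D * X * D * J + J := by noncomm_ring
    _ = J := by rw [hprod]; abel

/-- the transfer function `S(ω) = √(2Γ)(iωI + Γ − M)⁻¹√(2Γ) − I`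
is conjugate-symplectic: `S(ω) J S(ω)† = J`. -/
theorem transfer_function_conjugate_symplectic
    (N : ℕ) (hN : 0 < N)
    (J : Matrix (Fin N ⊕ Fin N) (Fin N ⊕ Fin N) ℝ)
    (hJ : J = Matrix.fromBlocks 0 1 (-1) 0)
    (Γ M : Matrix (Fin N ⊕ Fin N) (Fin N ⊕ Fin N) ℝ)
    (hΓdiag : Γ.IsDiag) (hΓnonneg : ∀ i, 0 ≤ Γ i i)
    (hΓskewHam : (J * Γ)ᵀ = -(J * Γ))
    (hMHam : (J * M)ᵀ = J * M)
    (ω : ℝ)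
    (A : Matrix (Fin N ⊕ Fin N) (Fin N ⊕ Fin N) ℂ)
    (hA : A = ((ω : ℂ) * Complex.I) • (1 : Matrix (Fin N ⊕ Fin N) (Fin N ⊕ Fin N) ℂ)
        + Γ.map (fun x => (x : ℂ)) - M.map (fun x => (x : ℂ)))
    (hinv : IsUnit A)
    (S : Matrix (Fin N ⊕ Fin N) (Fin N ⊕ Fin N) ℂ)
    (hS : S = (Matrix.diagonal fun i => (Real.sqrt (2 * Γ i i) : ℂ)) * A⁻¹ *
        (Matrix.diagonal fun i => (Real.sqrt (2 * Γ i i) : ℂ)) - 1) :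
    S * J.map (fun x => (x : ℂ)) * Sᴴ = J.map (fun x => (x : ℂ)) := by
  have hJJ : J * J = -1 := by
    rw [hJ, fromBlocks_multiply, ← fromBlocks_one, fromBlocks_neg]
    simp
  have hJT : Jᵀ = -J := by
    rw [hJ, fromBlocks_transpose, fromBlocks_neg]
    simp
  have hMJ : J * Mᵀ = -(M * J) := by
    have h1 : Mᵀ * J = -(J * M) := by
      rw [← hMHam, transpose_mul, hJT, mul_neg, neg_neg]
    have h2 : J * (Mᵀ * J) * J = J * -(J * M) * J := by rw [h1]
    have h3 : J * Mᵀ * (J * J) = -((J * J) * M * J) := by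
      simpa only [mul_neg, neg_mul, mul_assoc] using h2
    rw [hJJ] at h3
    simpa [neg_eq_iff_eq_neg] using h3
  have hΓeq : ∀ i, Γ (Sum.inl i) (Sum.inl i) = Γ (Sum.inr i) (Sum.inr i) := by
    intro i
    have h := congrFun (congrFun hΓskewHam (Sum.inl i)) (Sum.inr i)
    simp only [hJ, transpose_apply, Matrix.neg_apply, mul_apply, Fintype.sum_sum_type,
      fromBlocks_apply₁₁, fromBlocks_apply₁₂, fromBlocks_apply₂₁, fromBlocks_apply₂₂] at h
    simpa [one_apply] using h
  set D : Matrix (Fin N ⊕ Fin N) (Fin N ⊕ Fin N) ℂ :=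
    Matrix.diagonal fun i => (Real.sqrt (2 * Γ i i) : ℂ) with hD
  set K := J.map (fun x => (x : ℂ)) with hK
  set G := Γ.map (fun x => (x : ℂ)) with hG
  set L := M.map (fun x => (x : ℂ)) with hL
  have hDH : Dᴴ = D := by
    rw [hD, diagonal_conjTranspose]
    congr 1
    ext i
    simp
  have hGH : Gᴴ = G := by
    ext i j
    simpa [hG] using congrArg (fun x : ℝ => (x : ℂ)) (congrFun (congrFun hΓdiag.isSymm i) j)
  have hLK : K * Lᴴ = -(L * K) := by
    ext i j
    simpa [hK, hL, mul_apply] using congrArg (fun x : ℝ => (x : ℂ)) (congrFun (congrFun hMJ i) j)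
  have hDD : D * D = (2 : ℂ) • G := by
    ext i j
    rw [hD, diagonal_mul_diagonal]
    by_cases hij : i = j
    · subst hij
      have h := Real.mul_self_sqrt (mul_nonneg zero_le_two (hΓnonneg i))
      simpa [hG] using congrArg (fun x : ℝ => (x : ℂ)) h
    · simp [hG, hij, hΓdiag hij]
  have hDK : Commute D K := by
    change D * K = K * D
    ext i j
    rw [hD, diagonal_mul, mul_diagonal, hK, hJ]
    rcases i with i | i <;> rcases j with j | j <;> by_cases hij : i = j <;>
      simp [hij, one_apply, hΓeq]
  have hGK : G * K = K * G := by
    have h : D * D * K = K * (D * D) := (hDK.mul_left hDK).eq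
    rw [hDD, smul_mul_assoc, mul_smul_comm] at h
    exact smul_right_injective _ (two_ne_zero' ℂ) h
  have hAK : D * D * K = A * K + K * Aᴴ := by
    have hAH : Aᴴ = -(((ω : ℂ) * Complex.I) • 1) + G - Lᴴ := by
      simp [hA, hGH]
    rw [hAH, hA, hDD, two_smul, mul_sub, hLK, mul_add, mul_neg, ← hGK, sub_mul, add_mul]
    simp only [smul_mul_assoc, mul_smul_comm, one_mul, mul_one, add_mul]
    abel
  have hdet : IsUnit A.det := (isUnit_iff_isUnit_det A).mp hinv
  have hSH : Sᴴ = D * (A⁻¹)ᴴ * D - 1 := by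
    rw [hS, conjTranspose_sub, conjTranspose_mul, conjTranspose_mul, hDH, conjTranspose_one,
      mul_assoc]
  rw [hSH, hS]
  refine cayley_transform_mul_mul_eq hDK (nonsing_inv_mul A hdet) ?_ hAK
  rw [← conjTranspose_mul, nonsing_inv_mul A hdet, conjTranspose_one]
end

section
/- Let Γ be a real N×N diagonal matrix with strictly positive diagonal entries and let G be a complex N×N Hermitian matrix. Then for every real ω the matrix Γ − i(ωI + G) is invertible, and the passive (interferometer-with-memory-effect) transfer function U(ω) = √(2Γ)(Γ − i(ωI + G))⁻¹√(2Γ) − I is a unitary matrix. -/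
open Matrix

open scoped ComplexOrder in
/-- A complex matrix whose Hermitian part is positive definite is invertible. -/
theorem Matrix.isUnit_of_posDef_add_conjTranspose {n : Type*} [Fintype n] [DecidableEq n]
    {A : Matrix n n ℂ} (h : (A + Aᴴ).PosDef) : IsUnit A := by
  rw [← Matrix.mulVec_injective_iff_isUnit, ← Matrix.coe_mulVecLin, ← LinearMap.ker_eq_bot,
    LinearMap.ker_eq_bot']
  intro v hv
  rw [Matrix.mulVecLin_apply] at hv
  by_contra hne
  have hpos := h.dotProduct_mulVec_pos hne
  have hzero : star v ⬝ᵥ (Aᴴ *ᵥ v) = 0 := by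
    rw [Matrix.dotProduct_mulVec, ← Matrix.star_mulVec, hv, star_zero, zero_dotProduct]
  rw [Matrix.add_mulVec, hv, zero_add, hzero] at hpos
  exact lt_irrefl _ hpos

/-- The Cayley-type transform `S A⁻¹ S - 1` is unitary when `S` is Hermitian and `S²` is twice
the Hermitian part of the invertible matrix `A`. -/
theorem Matrix.mul_inv_mul_sub_one_mul_conjTranspose {n : Type*} [Fintype n] [DecidableEq n]
    {A S : Matrix n n ℂ} (hA : IsUnit A) (hS : S.IsHermitian) (h : A + Aᴴ = S * S) :
    (S * A⁻¹ * S - 1) * (S * A⁻¹ * S - 1)ᴴ = 1 := by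
  have hdet := (Matrix.isUnit_iff_isUnit_det A).mp hA
  have hright : Aᴴ * A⁻¹ᴴ = 1 := by
    rw [← Matrix.conjTranspose_mul, Matrix.nonsing_inv_mul A hdet, Matrix.conjTranspose_one]
  have hsum : A⁻¹ * (S * S) * A⁻¹ᴴ = A⁻¹ᴴ + A⁻¹ := by
    rw [← h, mul_add, add_mul, Matrix.nonsing_inv_mul A hdet, one_mul, mul_assoc A⁻¹ Aᴴ,
      hright, mul_one]
  rw [Matrix.conjTranspose_sub, Matrix.conjTranspose_mul, Matrix.conjTranspose_mul, hS.eq,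
    Matrix.conjTranspose_one]
  calc (S * A⁻¹ * S - 1) * (S * (A⁻¹ᴴ * S) - 1)
      = S * (A⁻¹ * (S * S) * A⁻¹ᴴ) * S - S * A⁻¹ * S - S * A⁻¹ᴴ * S + 1 := by noncomm_ring
    _ = 1 := by rw [hsum]; noncomm_ring

/-- for a real diagonal `Γ` with positive diagonal and complex
Hermitian `G`, the matrix `Γ − i(ωI + G)` is invertible for every real `ω`
and the passive (IME) transfer function
`U(ω) = √(2Γ)(Γ − i(ωI + G))⁻¹√(2Γ) − I` is unitary. -/
theorem passive_transfer_function_unitary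
    (N : ℕ) (Γ : Matrix (Fin N) (Fin N) ℝ)
    (hΓdiag : Γ.IsDiag) (hΓpos : ∀ i, 0 < Γ i i)
    (G : Matrix (Fin N) (Fin N) ℂ) (hG : G.IsHermitian)
    (ω : ℝ)
    (A : Matrix (Fin N) (Fin N) ℂ)
    (hA : A = Γ.map (fun x => (x : ℂ)) -
        Complex.I • ((ω : ℂ) • (1 : Matrix (Fin N) (Fin N) ℂ) + G))
    (U : Matrix (Fin N) (Fin N) ℂ)
    (hU : U = (Matrix.diagonal fun i => (Real.sqrt (2 * Γ i i) : ℂ)) * A⁻¹ *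
        (Matrix.diagonal fun i => (Real.sqrt (2 * Γ i i) : ℂ)) - 1) :
    IsUnit A ∧ U * Uᴴ = 1 := by
  have hS : (Matrix.diagonal fun i => (Real.sqrt (2 * Γ i i) : ℂ)).IsHermitian :=
    Matrix.isHermitian_diagonal_of_self_adjoint _ (funext fun i => Complex.conj_ofReal _)
  have hsqrt : (Matrix.diagonal fun i => (Real.sqrt (2 * Γ i i) : ℂ)) *
      (Matrix.diagonal fun i => (Real.sqrt (2 * Γ i i) : ℂ)) =
      Matrix.diagonal fun i => ((2 * Γ i i : ℝ) : ℂ) := by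
    rw [Matrix.diagonal_mul_diagonal]
    congr 1
    funext i
    rw [← Complex.ofReal_mul, Real.mul_self_sqrt (mul_pos two_pos (hΓpos i)).le]
  have hsum : A + Aᴴ = Matrix.diagonal fun i => ((2 * Γ i i : ℝ) : ℂ) := by
    have hmap : Γ.map (fun x => (x : ℂ)) = Matrix.diagonal fun i => (Γ i i : ℂ) := by
      conv_lhs => rw [← hΓdiag.diagonal_diag]
      exact Matrix.diagonal_map Complex.ofReal_zero
    have hstar : (Matrix.diagonal fun i => (Γ i i : ℂ))ᴴ =
        Matrix.diagonal fun i => (Γ i i : ℂ) :=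
      Matrix.isHermitian_diagonal_of_self_adjoint _ (funext fun i => Complex.conj_ofReal _)
    have hdouble : (Matrix.diagonal fun i => ((2 * Γ i i : ℝ) : ℂ)) =
        (Matrix.diagonal fun i => (Γ i i : ℂ)) + Matrix.diagonal fun i => (Γ i i : ℂ) := by
      rw [Matrix.diagonal_add]
      congr 1
      funext i
      push_cast
      ring
    rw [hA, hmap, hdouble, Matrix.conjTranspose_sub, hstar]
    simp only [Matrix.conjTranspose_smul, Matrix.conjTranspose_add, Matrix.conjTranspose_one,
      hG.eq, Complex.star_def, Complex.conj_I, Complex.conj_ofReal, neg_smul]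
    abel
  have hunit : IsUnit A := by
    refine Matrix.isUnit_of_posDef_add_conjTranspose ?_
    rw [hsum]
    open scoped ComplexOrder in
    exact Matrix.PosDef.diagonal fun i =>
      Complex.zero_lt_real.mpr (mul_pos two_pos (hΓpos i))
  refine ⟨hunit, ?_⟩
  rw [hU]
  exact Matrix.mul_inv_mul_sub_one_mul_conjTranspose hunit hS (hsum.trans hsqrt.symm)
end

section
/- Let U be a complex N×N unitary matrix, let m and p be distinct row indices and n any column index. Then there exists a two-level unitary T on the pair {m, p} such that the (m, n) entry of the product T·U is zero. (Any chosen element of a unitary matrix can be nulled by left-multiplication by a suitable two-level unitary acting on its row and one other row.) -/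
open Matrix

/-- A two-level unitary on a pair of distinct indices `{m, p}`: a unitary
matrix coinciding with the identity in every entry `(i, j)` except possibly
those with both `i` and `j` in `{m, p}`. -/
def IsTwoLevelUnitary {N : ℕ} (T : Matrix (Fin N) (Fin N) ℂ) (m p : Fin N) : Prop :=
  T ∈ Matrix.unitaryGroup (Fin N) ℂ ∧
    ∀ i j, ¬((i = m ∨ i = p) ∧ (j = m ∨ j = p)) →
      T i j = (1 : Matrix (Fin N) (Fin N) ℂ) i j

/-- The matrix acting as `!![c, s; -conj s, conj c]` on the coordinates `m, p` and as the identity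
on all others. -/
def twoLevelMatrix {N : ℕ} (m p : Fin N) (c s : ℂ) : Matrix (Fin N) (Fin N) ℂ :=
  Matrix.of fun i =>
    if i = m then Pi.single m c + Pi.single p s
    else if i = p then Pi.single m (-star s) + Pi.single p (star c)
    else Pi.single i 1

lemma twoLevelMatrix_mul_apply {N : ℕ} (m p : Fin N) (c s : ℂ) (A : Matrix (Fin N) (Fin N) ℂ)
    (i j : Fin N) :
    (twoLevelMatrix m p c s * A) i j =
      if i = m then c * A m j + s * A p j
      else if i = p then -star s * A m j + star c * A p j
      else A i j := by
  change (if i = m then Pi.single m c + Pi.single p s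
    else if i = p then Pi.single m (-star s) + Pi.single p (star c)
    else Pi.single i 1) ⬝ᵥ (fun k => A k j) = _
  split_ifs <;> simp [add_dotProduct, single_dotProduct]

lemma isTwoLevelUnitary_twoLevelMatrix {N : ℕ} {m p : Fin N} (hmp : m ≠ p) {c s : ℂ}
    (hcs : c * star c + s * star s = 1) : IsTwoLevelUnitary (twoLevelMatrix m p c s) m p := by
  refine ⟨?_, fun i j hij => ?_⟩
  · rw [Matrix.mem_unitaryGroup_iff]
    ext i j
    rw [twoLevelMatrix_mul_apply]
    simp only [star_apply, twoLevelMatrix, Matrix.of_apply, Matrix.one_apply]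
    split_ifs <;> simp_all [Pi.single_apply, eq_comm] <;> grind
  · simp only [twoLevelMatrix, Matrix.of_apply, Matrix.one_apply]
    split_ifs <;> simp_all

lemma exists_unit_pair_annihilating (a b : ℂ) :
    ∃ c s : ℂ, c * star c + s * star s = 1 ∧ c * a + s * b = 0 := by
  by_cases h : a = 0
  · exact ⟨1, 0, by simp, by simp [h]⟩
  have hpos : 0 < Complex.normSq a + Complex.normSq b :=
    add_pos_of_pos_of_nonneg (Complex.normSq_pos.2 h) (Complex.normSq_nonneg b)
  set r : ℝ := √(Complex.normSq a + Complex.normSq b)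
  have hr0 : (r : ℂ) ≠ 0 := by exact_mod_cast (Real.sqrt_pos.2 hpos).ne'
  have hr2 : (r : ℂ) ^ 2 = a * star a + b * star b := by
    simp only [Complex.star_def, Complex.mul_conj]
    exact_mod_cast Real.sq_sqrt hpos.le
  refine ⟨b / r, -a / r, ?_, by ring⟩
  simp only [Complex.star_def, map_div₀, map_neg, Complex.conj_ofReal] at hr2 ⊢
  field_simp
  linear_combination -hr2

/-- any chosen element of a unitary matrix can be nulled by
left-multiplication by a suitable two-level unitary acting on its row and one
other row. -/
theorem null_entry_by_left_two_level_unitary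
    (N : ℕ) (U : Matrix (Fin N) (Fin N) ℂ)
    (hU : U ∈ Matrix.unitaryGroup (Fin N) ℂ)
    (m p : Fin N) (hmp : m ≠ p) (n : Fin N) :
    ∃ T : Matrix (Fin N) (Fin N) ℂ, IsTwoLevelUnitary T m p ∧ (T * U) m n = 0 := by
  obtain ⟨c, s, hcs, h⟩ := exists_unit_pair_annihilating (U m n) (U p n)
  exact ⟨twoLevelMatrix m p c s, isTwoLevelUnitary_twoLevelMatrix hmp hcs, by
    simpa [twoLevelMatrix_mul_apply] using h⟩
end

section
/- Let U be a complex N×N unitary matrix, let n and q be distinct column indices and m any row index. Then there exists a two-level unitary T on the pair {n, q} such that the (m, n) entry of the product U·T† is zero, where † denotes the conjugate transpose. (Any chosen element of a unitary matrix can be nulled by right-multiplication by the adjoint of a suitable two-level unitary acting on its column and one other column.) -/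
open Matrix

/-- The matrix acting as `[[x, y], [-conj y, conj x]]` on the coordinates `n`, `q` and as the
identity elsewhere. -/
def planeRotation {N : ℕ} (n q : Fin N) (x y : ℂ) : Matrix (Fin N) (Fin N) ℂ :=
  1 + single n n (x - 1) + single n q y + single q n (-star y) + single q q (star x - 1)

lemma planeRotation_mem_unitaryGroup {N : ℕ} {n q : Fin N} (hnq : n ≠ q) {x y : ℂ}
    (hxy : x * star x + y * star y = 1) :
    planeRotation n q x y ∈ Matrix.unitaryGroup (Fin N) ℂ := by
  rw [Matrix.mem_unitaryGroup_iff, star_eq_conjTranspose, planeRotation]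
  simp only [conjTranspose_add, conjTranspose_one, conjTranspose_single, mul_add, add_mul,
    single_mul_single_same, single_mul_single_of_ne _ _ _ _ hnq,
    single_mul_single_of_ne _ _ _ _ hnq.symm, mul_one, one_mul, star_sub, star_neg, star_star,
    star_one]
  ext i j
  simp only [Matrix.add_apply, single_apply, Matrix.zero_apply]
  split_ifs <;> first | (exfalso; grind) | linear_combination hxy | ring

lemma isTwoLevelUnitary_planeRotation {N : ℕ} {n q : Fin N} (hnq : n ≠ q) {x y : ℂ}
    (hxy : x * star x + y * star y = 1) :
    IsTwoLevelUnitary (planeRotation n q x y) n q := by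
  refine ⟨planeRotation_mem_unitaryGroup hnq hxy, fun i j hij => ?_⟩
  simp only [planeRotation, Matrix.add_apply, single_apply]
  grind

lemma mul_conjTranspose_planeRotation_apply {N : ℕ} {n q : Fin N} (hnq : n ≠ q) (x y : ℂ)
    (U : Matrix (Fin N) (Fin N) ℂ) (m : Fin N) :
    (U * (planeRotation n q x y)ᴴ) m n = U m n * star x + U m q * star y := by
  simp only [planeRotation, conjTranspose_add, conjTranspose_one, conjTranspose_single, mul_add,
    mul_one, Matrix.add_apply, mul_single_apply_same, mul_single_apply_of_ne _ _ _ _ _ hnq, star_sub,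
    star_one]
  ring

lemma exists_unit_pair_orthogonal (a b : ℂ) :
    ∃ x y : ℂ, x * star x + y * star y = 1 ∧ a * star x + b * star y = 0 := by
  by_cases h : a = 0
  · exact ⟨1, 0, by simp, by simp [h]⟩
  have hpos : 0 < Complex.normSq a + Complex.normSq b :=
    add_pos_of_pos_of_nonneg (Complex.normSq_pos.2 h) (Complex.normSq_nonneg b)
  set r : ℝ := √(Complex.normSq a + Complex.normSq b) with hr
  have hr0 : (r : ℂ) ≠ 0 := Complex.ofReal_ne_zero.2 (Real.sqrt_pos.2 hpos).ne'
  have hr2 : (r : ℂ) ^ 2 = a * star a + b * star b := by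
    rw [← Complex.ofReal_pow, hr, Real.sq_sqrt hpos.le]
    simp [Complex.mul_conj]
  refine ⟨star b / r, -star a / r, ?_, ?_⟩
  · simp only [star_div₀, star_neg, Complex.star_def, Complex.conj_ofReal,
      Complex.conj_conj] at hr2 ⊢
    field_simp
    linear_combination -hr2
  · simp only [star_div₀, star_neg, star_star]
    ring

/-- any chosen element of a unitary matrix can be nulled by
right-multiplication by the adjoint of a suitable two-level unitary acting on
its column and one other column. -/
theorem null_entry_by_right_two_level_unitary
    (N : ℕ) (U : Matrix (Fin N) (Fin N) ℂ)
    (hU : U ∈ Matrix.unitaryGroup (Fin N) ℂ)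
    (n q : Fin N) (hnq : n ≠ q) (m : Fin N) :
    ∃ T : Matrix (Fin N) (Fin N) ℂ, IsTwoLevelUnitary T n q ∧ (U * Tᴴ) m n = 0 := by
  obtain ⟨x, y, hxy, hzero⟩ := exists_unit_pair_orthogonal (U m n) (U m q)
  exact ⟨planeRotation n q x y, isTwoLevelUnitary_planeRotation hnq hxy,
    (mul_conjTranspose_planeRotation_apply hnq x y U m).trans hzero⟩
end

section
/- Every complex 2×2 unitary matrix U can be written as U = D(α₁, α₂) · T^{MZI}(φ, θ), where D(α₁, α₂) = [[e^{iα₁}, 0],[0, e^{iα₂}]] is a diagonal phase matrix and T^{MZI}(φ, θ) = [[e^{iφ}cos θ, −sin θ],[e^{iφ}sin θ, cos θ]] is a Mach–Zehnder interferometer matrix, for some real numbers α₁, α₂, φ, θ. -/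
open Matrix

/-- The first column of a 2×2 unitary is determined by its second column and its determinant,
and the second column has norm one. -/
lemma unitary_fin_two_entries (U : Matrix (Fin 2) (Fin 2) ℂ)
    (hU : U ∈ Matrix.unitaryGroup (Fin 2) ℂ) :
    U 0 0 = U.det * star (U 1 1) ∧ U 1 0 = -(U.det * star (U 0 1)) ∧
      ‖U 0 1‖ ^ 2 + ‖U 1 1‖ ^ 2 = 1 := by
  have hrow := Matrix.mem_unitaryGroup_iff.mp hU
  have hcol := Matrix.mem_unitaryGroup_iff'.mp hU
  have h00 := congrFun₂ hrow 0 0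
  have h01 := congrFun₂ hrow 0 1
  have h10 := congrFun₂ hrow 1 0
  have h11 := congrFun₂ hrow 1 1
  have hnorm := congrFun₂ hcol 1 1
  simp only [Matrix.mul_apply, Matrix.star_apply, Fin.sum_univ_two, Matrix.one_apply_eq,
    Matrix.one_apply, Fin.isValue, zero_ne_one, one_ne_zero, if_false] at h00 h01 h10 h11 hnorm
  rw [Matrix.det_fin_two]
  refine ⟨?_, ?_, ?_⟩
  · linear_combination U 1 0 * h01 - U 0 0 * h11
  · linear_combination U 0 0 * h10 - U 1 0 * h00
  · have h : ((‖U 0 1‖ ^ 2 + ‖U 1 1‖ ^ 2 : ℝ) : ℂ) = 1 := by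
      push_cast
      rw [← Complex.conj_mul', ← Complex.conj_mul']
      exact hnorm
    exact_mod_cast h

/-- every 2×2 unitary factors as a diagonal phase matrix times a
Mach–Zehnder interferometer matrix. -/
theorem unitary_2x2_phase_mzi_decomposition
    (U : Matrix (Fin 2) (Fin 2) ℂ)
    (hU : U ∈ Matrix.unitaryGroup (Fin 2) ℂ) :
    ∃ α₁ α₂ φ θ : ℝ,
      U = !![Complex.exp ((α₁ : ℂ) * Complex.I), 0;
             0, Complex.exp ((α₂ : ℂ) * Complex.I)] *
          !![Complex.exp ((φ : ℂ) * Complex.I) * (Real.cos θ : ℂ), -(Real.sin θ : ℂ);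
             Complex.exp ((φ : ℂ) * Complex.I) * (Real.sin θ : ℂ), (Real.cos θ : ℂ)] := by
  obtain ⟨h00, h10, hnorm⟩ := unitary_fin_two_entries U hU
  have hdet : ‖U.det‖ = 1 := CStarRing.norm_of_mem_unitary (Matrix.det_of_mem_unitary hU)
  have hD := Complex.norm_mul_exp_arg_mul_I U.det
  have hb := Complex.norm_mul_exp_arg_mul_I (-U 0 1)
  have hd := Complex.norm_mul_exp_arg_mul_I (U 1 1)
  rw [hdet, Complex.ofReal_one, one_mul] at hD
  rw [norm_neg] at hb
  have hcos : Real.cos (Real.arccos ‖U 1 1‖) = ‖U 1 1‖ :=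
    Real.cos_arccos (by linarith [norm_nonneg (U 1 1)]) (by nlinarith [sq_nonneg ‖U 0 1‖])
  have hsin : Real.sin (Real.arccos ‖U 1 1‖) = ‖U 0 1‖ := by
    rw [Real.sin_arccos, ← hnorm, add_sub_cancel_right, Real.sqrt_sq (norm_nonneg _)]
  refine ⟨(-U 0 1).arg, (U 1 1).arg, U.det.arg - (-U 0 1).arg - (U 1 1).arg,
    Real.arccos ‖U 1 1‖, ?_⟩
  rw [hcos, hsin]
  generalize (-U 0 1).arg = α₁ at *
  generalize (U 1 1).arg = α₂ at *
  generalize U.det.arg = δ at *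
  have hstar (x : ℝ) : star (Complex.exp (x * Complex.I)) = Complex.exp (-(x * Complex.I)) := by
    rw [Complex.star_def, ← Complex.exp_conj]
    simp
  have hstar_d : star (U 1 1) = ‖U 1 1‖ * Complex.exp (-(α₂ * Complex.I)) := by
    rw [← hstar]
    conv_lhs => rw [← hd]
    simp
  have hstar_b : -star (U 0 1) = ‖U 0 1‖ * Complex.exp (-(α₁ * Complex.I)) := by
    rw [← hstar, ← star_neg]
    conv_lhs => rw [← hb]
    simp
  have hφ₁ : Complex.exp (α₁ * Complex.I) * Complex.exp ((δ - α₁ - α₂ : ℝ) * Complex.I) =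
      U.det * Complex.exp (-(α₂ * Complex.I)) := by
    rw [← hD, ← Complex.exp_add, ← Complex.exp_add]
    push_cast
    ring_nf
  have hφ₂ : Complex.exp (α₂ * Complex.I) * Complex.exp ((δ - α₁ - α₂ : ℝ) * Complex.I) =
      U.det * Complex.exp (-(α₁ * Complex.I)) := by
    rw [← hD, ← Complex.exp_add, ← Complex.exp_add]
    push_cast
    ring_nf
  ext i j
  fin_cases i <;> fin_cases j <;>
    simp only [Matrix.mul_apply, Fin.sum_univ_two, Matrix.of_apply, Matrix.cons_val', Fin.zero_eta,
      Fin.mk_one, Fin.isValue, Matrix.cons_val_zero, Matrix.cons_val_one, Matrix.cons_val_fin_one]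
  · linear_combination h00 + U.det * hstar_d - ‖U 1 1‖ * hφ₁
  · linear_combination hb
  · linear_combination h10 + U.det * hstar_b - ‖U 0 1‖ * hφ₂
  · linear_combination -hd
end
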